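/- Two 1-dimensional ℚ-lattices (λ₁ℤ, λ₁ρ₁) and (λ₂ℤ, λ₂ρ₂), with λ₁, λ₂ > 0 and ρ₁, ρ₂ ∈ Hom(ℚ/ℤ, ℚ/ℤ), are commensurable if and only if there exist positive integers m and n such that mλ₁ = nλ₂ and n·ρ₁ = m·ρ₂ in Hom(ℚ/ℤ, ℚ/ℤ), i.e. (nρ₁ − mρ₂)(x) = 0 in ℚ/ℤ for all x ∈ ℚ/ℤ. -/

import Mathlib

/-- The abelian group `ℚ/ℤ`. -/
abbrev QZ : Type := ℚ ⧸ AddSubgroup.zmultiples (1 : ℚ)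

/-- For `λ ∈ ℝ`, the homomorphism `ℚ/ℤ → ℝ/λℤ` induced by `q ↦ λ·q`; for `ρ : ℚ/ℤ → ℚ/ℤ`
the `ℚ`-lattice `(λℤ, λρ)` has homomorphism `(scaleHom λ).comp ρ`, i.e.
`x ↦ λ·q + λℤ` where `q` is any rational representative of `ρ(x)`. -/
noncomputable def scaleHom (l : ℝ) : QZ →+ ℝ ⧸ AddSubgroup.zmultiples l :=
  QuotientAddGroup.map (AddSubgroup.zmultiples (1 : ℚ)) (AddSubgroup.zmultiples l)
    ((AddMonoidHom.mulLeft l).comp (Rat.castHom ℝ).toAddMonoidHom)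
    (by
      intro q hq
      obtain ⟨n, rfl⟩ := AddSubgroup.mem_zmultiples_iff.mp hq
      refine AddSubgroup.mem_comap.mpr (AddSubgroup.mem_zmultiples_iff.mpr ⟨n, ?_⟩)
      simp only [AddMonoidHom.comp_apply, RingHom.toAddMonoidHom_eq_coe,
        AddMonoidHom.coe_coe, AddMonoidHom.coe_mulLeft, zsmul_eq_mul]
      rw [mul_one, map_intCast]
      ring)

/-- Commensurability of two 1-dimensional `ℚ`-lattices `(Λ₁, φ₁)`, `(Λ₂, φ₂)`:
`ℚΛ₁ = ℚΛ₂` and `(φ₁ - φ₂)(x) ∈ Λ₁ + Λ₂` for all `x ∈ ℚ/ℤ`, i.e. the images of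
`φ₁(x)` and `φ₂(x)` under the natural projections `ℝ/Λᵢ → ℝ/(Λ₁ + Λ₂)` coincide. -/
def Commensurable1 (Λ₁ Λ₂ : AddSubgroup ℝ) (φ₁ : QZ →+ ℝ ⧸ Λ₁) (φ₂ : QZ →+ ℝ ⧸ Λ₂) : Prop :=
  Submodule.span ℚ (Λ₁ : Set ℝ) = Submodule.span ℚ (Λ₂ : Set ℝ) ∧
  ∀ x : QZ,
    QuotientAddGroup.map Λ₁ (Λ₁ ⊔ Λ₂) (AddMonoidHom.id ℝ)
      (by rw [AddSubgroup.comap_id]; exact le_sup_left) (φ₁ x) =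
    QuotientAddGroup.map Λ₂ (Λ₁ ⊔ Λ₂) (AddMonoidHom.id ℝ)
      (by rw [AddSubgroup.comap_id]; exact le_sup_right) (φ₂ x)

theorem sup_aux (l : ℝ) (m n : ℕ) (h : Nat.Coprime m n) :
    AddSubgroup.zmultiples ((n : ℝ) * l) ⊔ AddSubgroup.zmultiples ((m : ℝ) * l)
      = AddSubgroup.zmultiples l := by
  apply le_antisymm
  · rw [sup_le_iff, AddSubgroup.zmultiples_le, AddSubgroup.zmultiples_le]
    exact ⟨AddSubgroup.mem_zmultiples_iff.mpr ⟨n, by simp⟩,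
      AddSubgroup.mem_zmultiples_iff.mpr ⟨m, by simp⟩⟩
  · rw [AddSubgroup.zmultiples_le]
    have hb : (1 : ℤ) = m * Nat.gcdA m n + n * Nat.gcdB m n := by
      have := Nat.gcd_eq_gcd_ab m n
      rw [h] at this
      exact_mod_cast this
    have hb' : (1 : ℝ) = m * (Nat.gcdA m n : ℤ) + n * (Nat.gcdB m n : ℤ) := by
      exact_mod_cast hb
    refine AddSubgroup.mem_sup.mpr ⟨_, AddSubgroup.mem_zmultiples_iff.mpr ⟨Nat.gcdB m n, rfl⟩,
      _, AddSubgroup.mem_zmultiples_iff.mpr ⟨Nat.gcdA m n, rfl⟩, ?_⟩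
    simp only [zsmul_eq_mul]
    linear_combination (-l) * hb'

theorem key_aux (l l₁ l₂ : ℝ) (hl : 0 < l) (m n : ℕ) (h : Nat.Coprime m n)
    (h₁ : l₁ = n * l) (h₂ : l₂ = m * l) (x₁ x₂ : QZ) :
    QuotientAddGroup.map (AddSubgroup.zmultiples l₁)
      (AddSubgroup.zmultiples l₁ ⊔ AddSubgroup.zmultiples l₂) (AddMonoidHom.id ℝ)
      (by rw [AddSubgroup.comap_id]; exact le_sup_left) (scaleHom l₁ x₁) =
    QuotientAddGroup.map (AddSubgroup.zmultiples l₂)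
      (AddSubgroup.zmultiples l₁ ⊔ AddSubgroup.zmultiples l₂) (AddMonoidHom.id ℝ)
      (by rw [AddSubgroup.comap_id]; exact le_sup_right) (scaleHom l₂ x₂) ↔
    n • x₁ = m • x₂ := by
  obtain ⟨q₁, rfl⟩ := QuotientAddGroup.mk_surjective x₁
  obtain ⟨q₂, rfl⟩ := QuotientAddGroup.mk_surjective x₂
  have e1 : (n • (q₁ : QZ) = m • (q₂ : QZ)) ↔ ∃ k : ℤ, (k : ℚ) = -(n * q₁) + m * q₂ := by
    rw [← QuotientAddGroup.mk_nsmul, ← QuotientAddGroup.mk_nsmul, QuotientAddGroup.eq,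
      AddSubgroup.mem_zmultiples_iff]
    simp
  have e2 : (((l₁ * (q₁ : ℝ) : ℝ) : ℝ ⧸ (AddSubgroup.zmultiples l₁ ⊔ AddSubgroup.zmultiples l₂))
      = ((l₂ * (q₂ : ℝ) : ℝ) : ℝ ⧸ (AddSubgroup.zmultiples l₁ ⊔ AddSubgroup.zmultiples l₂))) ↔
      ∃ k : ℤ, (k : ℚ) = -(n * q₁) + m * q₂ := by
    rw [QuotientAddGroup.eq]
    subst h₁ h₂
    rw [sup_aux l m n h, AddSubgroup.mem_zmultiples_iff]
    refine exists_congr fun k => ?_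
    rw [zsmul_eq_mul, ← (Rat.cast_injective (α := ℝ)).eq_iff]
    push_cast
    constructor
    · intro hk
      apply mul_right_cancel₀ hl.ne'
      rw [hk]; ring
    · intro hk
      rw [hk]; ring
  rw [e1, ← e2]
  rfl

theorem span_aux (l : ℝ) :
    Submodule.span ℚ (AddSubgroup.zmultiples l : Set ℝ) = Submodule.span ℚ {l} := by
  apply le_antisymm
  · rw [Submodule.span_le]
    intro x hx
    obtain ⟨k, rfl⟩ := AddSubgroup.mem_zmultiples_iff.mp hx
    exact zsmul_mem (Submodule.mem_span_singleton_self l) k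
  · apply Submodule.span_mono
    simp

theorem torsion_aux (k : ℕ) (hk : 0 < k) (a b : QZ →+ QZ) (h : k • a = k • b) : a = b := by
  ext x
  obtain ⟨y, hy⟩ : ∃ y : QZ, k • y = QuotientAddGroup.mk' _ x := by
    refine ⟨((x / k : ℚ) : QZ), ?_⟩
    rw [← QuotientAddGroup.mk_nsmul, nsmul_eq_mul, mul_div_cancel₀ _ (by positivity)]
    rfl
  have := DFunLike.congr_fun h y
  simp only [AddMonoidHom.coe_smul, Pi.smul_apply, ← map_nsmul, hy] at this
  exact this

/-- Two 1-dimensional `ℚ`-lattices `(λ₁ℤ, λ₁ρ₁)` and `(λ₂ℤ, λ₂ρ₂)` (with `λ₁, λ₂ > 0`) are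
commensurable iff there are positive integers `m, n` with `mλ₁ = nλ₂` and `n·ρ₁ = m·ρ₂`. -/
theorem commensurable1_iff (l₁ l₂ : ℝ) (hl₁ : 0 < l₁) (hl₂ : 0 < l₂)
    (ρ₁ ρ₂ : QZ →+ QZ) :
    Commensurable1 (AddSubgroup.zmultiples l₁) (AddSubgroup.zmultiples l₂)
      ((scaleHom l₁).comp ρ₁) ((scaleHom l₂).comp ρ₂) ↔
    ∃ m n : ℕ, 0 < m ∧ 0 < n ∧ (m : ℝ) * l₁ = (n : ℝ) * l₂ ∧ n • ρ₁ = m • ρ₂ := by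
  constructor
  · rintro ⟨hs, hx⟩
    rw [span_aux, span_aux] at hs
    have hmem : l₁ ∈ Submodule.span ℚ {l₂} := hs ▸ Submodule.mem_span_singleton_self l₁
    obtain ⟨r, hr⟩ := Submodule.mem_span_singleton.mp hmem
    rw [Rat.smul_def] at hr
    have hrpos : 0 < r := by
      have : (0 : ℝ) < r := by
        by_contra hc
        nlinarith
      exact_mod_cast this
    -- r = n / m
    have hnum : 0 < r.num := Rat.num_pos.mpr hrpos
    have hden : (0 : ℝ) < r.den := by exact_mod_cast r.den_pos
    have hcast : ((r.num.natAbs : ℕ) : ℝ) = (r.num : ℝ) := by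
      rw [Nat.cast_natAbs, abs_of_pos hnum]
    have hrr : (r : ℝ) * r.den = r.num := by exact_mod_cast Rat.mul_den_eq_num r
    refine ⟨r.den, r.num.natAbs, r.den_pos, Int.natAbs_pos.mpr hnum.ne', ?_, ?_⟩
    · rw [hcast, ← hrr, ← hr]; ring
    · ext x
      have := (key_aux (l₂ / r.den) l₁ l₂ (by positivity) r.den r.num.natAbs
        (Nat.Coprime.symm r.reduced) (by rw [hcast, ← hrr, ← hr]; field_simp)
        (by field_simp) _ _).mp (hx (QuotientAddGroup.mk' _ x))
      exact this
  · rintro ⟨m, n, hm, hn, hl, hρ⟩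
    obtain ⟨g, m', n', hg, hco, rfl, rfl⟩ := Nat.exists_coprime' (Nat.gcd_pos_of_pos_left n hm)
    have hρ' : n' • ρ₁ = m' • ρ₂ := by
      apply torsion_aux g hg
      rw [← mul_nsmul, ← mul_nsmul, hρ]
    have hm' : (0 : ℝ) < m' := by exact_mod_cast Nat.pos_of_mul_pos_right hm
    have hn' : (0 : ℝ) < n' := by exact_mod_cast Nat.pos_of_mul_pos_right hn
    have hg' : (0 : ℝ) < g := by exact_mod_cast hg
    have hl' : (m' : ℝ) * l₁ = n' * l₂ := by
      apply mul_right_cancel₀ hg'.ne'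
      push_cast at hl
      linear_combination hl
    refine ⟨?_, fun x => ?_⟩
    · rw [span_aux, span_aux]
      apply le_antisymm
      · rw [Submodule.span_singleton_le_iff_mem, Submodule.mem_span_singleton]
        refine ⟨(n' : ℚ) / m', ?_⟩
        rw [Rat.smul_def]; push_cast; field_simp; linarith
      · rw [Submodule.span_singleton_le_iff_mem, Submodule.mem_span_singleton]
        refine ⟨(m' : ℚ) / n', ?_⟩
        rw [Rat.smul_def]; push_cast; field_simp; linarith
    · refine (key_aux (l₁ / n') l₁ l₂ (by positivity) m' n' hco (by field_simp)
        (by field_simp; linarith) _ _).mpr ?_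
      exact DFunLike.congr_fun hρ' x
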